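/- For every non-negative integer n, the number of partitions of 7n + 5 is divisible by 7; that is, P(7n + 5) ≡ 0 (mod 7). -/

import Mathlib

/-- Number of unordered partitions of `n` (so `P 0 = 1`, via the empty partition). -/
def P (n : ℕ) : ℕ := Fintype.card (Nat.Partition n)

/-- Total number of occurrences of `k`, counted with multiplicity,
among all unordered partitions of `n` (so `Q k 0 = 0`). -/
def Q (k n : ℕ) : ℕ := ∑ p : Nat.Partition n, p.parts.count k

/-- Sum over all unordered partitions of `n` of the number of distinct parts. -/
def S (n : ℕ) : ℕ := ∑ p : Nat.Partition n, p.parts.toFinset.card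

/-- Number of unordered partitions of `n` containing `k` as a part. -/
def R (k n : ℕ) : ℕ := (Finset.univ.filter (fun p : Nat.Partition n => k ∈ p.parts)).card

namespace RamSeven

open Finset

section general
variable {R : Type*} [CommRing R]

/-- Gaussian binomials, by the Pascal recursion. -/
def gb (q : R) : ℕ → ℕ → R
  | _, 0 => 1
  | 0, _ + 1 => 0
  | m + 1, k + 1 => gb q m k + q ^ (k + 1) * gb q m (k + 1)

/-- The finite Euler product. -/
def E (q : R) (n : ℕ) : R := ∏ i ∈ range n, (1 - q ^ (i + 1))

lemma E_succ (q : R) (n : ℕ) : E q (n + 1) = E q n * (1 - q ^ (n + 1)) := by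
  simp [E, prod_range_succ]

lemma gb_zero (q : R) (m : ℕ) : gb q m 0 = 1 := by cases m <;> rfl

lemma gb_succ (q : R) (m k : ℕ) :
    gb q (m + 1) (k + 1) = gb q m k + q ^ (k + 1) * gb q m (k + 1) := rfl

lemma gb_lt (q : R) (m : ℕ) : ∀ k, m < k → gb q m k = 0 := by
  induction m with
  | zero => intro k hk; obtain ⟨k, rfl⟩ := Nat.exists_eq_succ_of_ne_zero hk.ne'; rfl
  | succ m ih =>
    intro k hk
    obtain ⟨k, rfl⟩ := Nat.exists_eq_succ_of_ne_zero (Nat.ne_zero_of_lt hk)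
    rw [Nat.succ_eq_add_one, gb_succ, ih k (by omega), ih (k + 1) (by omega)]; simp

lemma gb_self (q : R) (m : ℕ) : gb q m m = 1 := by
  induction m with
  | zero => rfl
  | succ m ih => rw [gb_succ, ih, gb_lt q m (m + 1) (by omega)]; simp

lemma gb_E (q : R) : ∀ s a b, a + b = s → gb q s a * E q a * E q b = E q s := by
  intro s
  induction s with
  | zero =>
    intro a b h
    obtain ⟨rfl, rfl⟩ : a = 0 ∧ b = 0 := by omega
    simp [E, gb_zero]
  | succ s ih =>
    intro a b h
    rcases a with _ | a
    · obtain rfl : b = s + 1 := by omega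
      simp [E, gb_zero]
    rcases b with _ | b
    · obtain rfl : a = s := by omega
      simp [E, gb_self]
    have h1 := ih a (b + 1) (by omega)
    have h2 := ih (a + 1) b (by omega)
    have hs : s + 1 = (a + 1) + (b + 1) := by omega
    rw [gb_succ, E_succ q s]
    rw [E_succ q b] at h1 ⊢
    rw [E_succ q a] at h2 ⊢
    rw [show q ^ (s + 1) = q ^ (a + 1) * q ^ (b + 1) by rw [hs, pow_add]]
    linear_combination (1 - q ^ (a + 1)) * h1 + q ^ (a + 1) * (1 - q ^ (b + 1)) * h2

lemma gb_map {S : Type*} [CommRing S] (f : R →+* S) (q : R) (m : ℕ) :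
    ∀ k, gb (f q) m k = f (gb q m k) := by
  induction m with
  | zero => intro k; cases k <;> simp [gb]
  | succ m ih => intro k; cases k <;> simp [gb, ih]

lemma qbinom (q x : R) (m : ℕ) : ∀ y, ∏ i ∈ range m, (x + y * q ^ i) =
    ∑ k ∈ range (m + 1), q ^ (k.choose 2) * gb q m k * x ^ (m - k) * y ^ k := by
  induction m with
  | zero => intro y; simp [gb]
  | succ m ih =>
    intro y
    have e : ∀ i, x + y * q ^ (i + 1) = x + (y * q) * q ^ i := fun i => by ring
    rw [prod_range_succ', prod_congr rfl (fun i _ => e i), ih, sum_range_succ' _ (m + 1)]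
    have c2 : ∀ k : ℕ, (k + 1).choose 2 = k + k.choose 2 := fun k => by
      rw [Nat.choose_succ_succ' k 1, Nat.choose_one_right]
    have s1 : ∑ k ∈ range (m + 1), q ^ ((k + 1).choose 2) * gb q (m + 1) (k + 1) *
          x ^ (m + 1 - (k + 1)) * y ^ (k + 1) =
        y * (∑ k ∈ range (m + 1), q ^ (k.choose 2) * gb q m k * x ^ (m - k) * (y * q) ^ k) +
        ∑ k ∈ range (m + 1), q ^ ((k + 1).choose 2) * gb q m (k + 1) * x ^ (m - k) *
          (y * q) ^ (k + 1) := by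
      rw [mul_sum, ← sum_add_distrib]
      refine sum_congr rfl fun k _ => ?_
      rw [gb_succ, c2, show m + 1 - (k + 1) = m - k by omega]
      ring
    have s2 : x * (∑ k ∈ range (m + 1), q ^ (k.choose 2) * gb q m k * x ^ (m - k) * (y * q) ^ k) =
        x ^ (m + 1) + ∑ k ∈ range (m + 1), q ^ ((k + 1).choose 2) * gb q m (k + 1) * x ^ (m - k) *
          (y * q) ^ (k + 1) := by
      rw [sum_range_succ', sum_range_succ _ m, gb_lt q m (m + 1) (by omega), mul_add, mul_sum]
      have : ∀ k ∈ range m, x * (q ^ ((k + 1).choose 2) * gb q m (k + 1) * x ^ (m - (k + 1)) *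
          (y * q) ^ (k + 1)) = q ^ ((k + 1).choose 2) * gb q m (k + 1) * x ^ (m - k) *
          (y * q) ^ (k + 1) := by
        intro k hk
        rw [mem_range] at hk
        rw [show m - k = (m - (k + 1)) + 1 by omega, pow_succ]
        ring
      rw [sum_congr rfl this]
      simp [gb_zero]
      ring
    rw [s1]
    simp only [gb_zero]
    simp
    linear_combination s2

lemma choose_two' (k : ℕ) : 2 * k.choose 2 + k = k * k := by
  induction k with
  | zero => simp
  | succ k ih => rw [Nat.choose_succ_succ' k 1, Nat.choose_one_right]; linarith

open Polynomial in
lemma deriv_id (q : R) (n : ℕ) :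
    (∏ i ∈ range n, (q ^ n - q ^ i)) * (∏ i ∈ range n, (q ^ n - q ^ (n + (i + 1)))) * (- q ^ n) =
    ∑ k ∈ range ((n + 1) + (n + 1)), q ^ (k.choose 2) * gb q (2 * n + 1) k *
      (q ^ n) ^ (2 * n + 1 - k) * ((-1) ^ k * k) := by
  have h := qbinom (C q) (C q ^ n) (2 * n + 1) (-X)
  have h' := congrArg (fun p => eval 1 (derivative p)) h
  beta_reduce at h'
  rw [show 2 * n + 1 = n + (n + 1) by ring, prod_range_add, prod_range_succ'] at h'
  rw [show (n + 1) + (n + 1) = 2 * n + 1 + 1 by ring]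
  rw [show n + (n + 1) = 2 * n + 1 by ring] at h'
  rw [derivative_sum, eval_finsetSum] at h'
  have r : ∀ k, eval 1 (derivative (C q ^ (k.choose 2) * gb (C q) (2 * n + 1) k *
      (C q ^ n) ^ (2 * n + 1 - k) * (-X) ^ k)) = q ^ (k.choose 2) * gb q (2 * n + 1) k *
      (q ^ n) ^ (2 * n + 1 - k) * ((-1) ^ k * k) := by
    intro k
    rw [gb_map C q, ← C_pow, ← C_pow, ← C_pow, ← C_mul, ← C_mul, derivative_C_mul,
      neg_pow, ← C_1, ← C_neg, ← C_pow, derivative_C_mul, derivative_X_pow]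
    simp
  rw [sum_congr rfl (fun k _ => r k)] at h'
  rw [← h']
  simp only [derivative_mul, eval_add, eval_mul, eval_prod]
  simp [← C_pow, -map_pow, ← sub_eq_add_neg]
  ring

lemma prod_A (q : R) (n : ℕ) :
    ∏ i ∈ range n, (q ^ n - q ^ i) = (-1) ^ n * q ^ (n.choose 2) * E q n := by
  have : ∀ i ∈ range n, q ^ n - q ^ i = (-1) * q ^ i * (1 - q ^ (n - 1 - i + 1)) := by
    intro i hi
    rw [mem_range] at hi
    have : q ^ n = q ^ i * q ^ (n - 1 - i + 1) := by rw [← pow_add]; congr 1; omega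
    rw [this]; ring
  rw [prod_congr rfl this, prod_mul_distrib, prod_mul_distrib,
    prod_range_reflect (fun i => 1 - q ^ (i + 1)) n, prod_pow_eq_pow_sum, sum_range_id]
  simp [E, Nat.choose_two_right]

lemma prod_B (q : R) (n : ℕ) :
    ∏ i ∈ range n, (q ^ n - q ^ (n + (i + 1))) = q ^ (n * n) * E q n := by
  have : ∀ i ∈ range n, q ^ n - q ^ (n + (i + 1)) = q ^ n * (1 - q ^ (i + 1)) := by
    intro i hi; ring
  rw [prod_congr rfl this, prod_mul_distrib]
  simp [E, pow_mul]

lemma E_reg [IsDomain R] {q : R} (hE : ∀ n, E q n ≠ 0) (a b : ℕ) :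
    gb q (a + b) a = gb q (a + b) b := by
  have h1 := gb_E q (a + b) a b rfl
  have h2 := gb_E q (a + b) b a (by omega)
  apply mul_right_cancel₀ (mul_ne_zero (hE a) (hE b))
  linear_combination h1 - h2

lemma jacobi_fin [IsDomain R] {q : R} (hq : q ≠ 0) (hE : ∀ n, E q n ≠ 0) (n : ℕ) :
    E q n ^ 2 = ∑ j ∈ range (n + 1), (-1) ^ j * (2 * j + 1) * q ^ ((j + 1).choose 2) *
      gb q (2 * n + 1) (n + 1 + j) := by
  have h := deriv_id q n
  rw [prod_A, prod_B, sum_range_add, ← sum_range_reflect _ (n + 1), ← sum_add_distrib] at h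
  have t : ∀ j ∈ range (n + 1), q ^ ((n + 1 - 1 - j).choose 2) * gb q (2 * n + 1) (n + 1 - 1 - j) *
      (q ^ n) ^ (2 * n + 1 - (n + 1 - 1 - j)) *
        ((-1) ^ (n + 1 - 1 - j) * ((n + 1 - 1 - j : ℕ) : R)) +
      q ^ ((n + 1 + j).choose 2) * gb q (2 * n + 1) (n + 1 + j) *
      (q ^ n) ^ (2 * n + 1 - (n + 1 + j)) * ((-1) ^ (n + 1 + j) * ((n + 1 + j : ℕ) : R)) =
      ((-1) ^ (n + 1) * q ^ (n.choose 2 + n * n + n)) * ((-1) ^ j * (2 * j + 1) *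
        q ^ ((j + 1).choose 2) * gb q (2 * n + 1) (n + 1 + j)) := by
    intro j hj
    rw [mem_range] at hj
    obtain ⟨i, rfl⟩ : ∃ i, n = j + i := ⟨n - j, by omega⟩
    have sym := E_reg hE i (j + i + 1 + j)
    rw [show i + (j + i + 1 + j) = 2 * (j + i) + 1 by ring] at sym
    rw [show j + i + 1 - 1 - j = i by omega,
      show 2 * (j + i) + 1 - i = j + i + 1 + j by omega,
      show 2 * (j + i) + 1 - (j + i + 1 + j) = i by omega, sym]
    have e1 : q ^ (i.choose 2) * (q ^ (j + i)) ^ (j + i + 1 + j) =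
        q ^ ((j + i).choose 2 + (j + i) * (j + i) + (j + i)) * q ^ ((j + 1).choose 2) := by
      rw [← pow_mul, ← pow_add, ← pow_add]
      congr 1
      have := choose_two' i
      have := choose_two' (j + i)
      have := choose_two' (j + 1)
      nlinarith
    have e2 : q ^ ((j + i + 1 + j).choose 2) * (q ^ (j + i)) ^ i =
        q ^ ((j + i).choose 2 + (j + i) * (j + i) + (j + i)) * q ^ ((j + 1).choose 2) := by
      rw [← pow_mul, ← pow_add, ← pow_add]
      congr 1
      have := choose_two' (j + i + 1 + j)
      have := choose_two' (j + i)
      have := choose_two' (j + 1)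
      nlinarith
    have sg : ((-1 : R) ^ j) * (-1) ^ j = 1 := by rw [← mul_pow]; simp
    have sg' : (-1 : R) ^ i = (-1) ^ (j + i) * (-1) ^ j := by
      rw [pow_add]; linear_combination - (-1) ^ i * sg
    generalize gb q (2 * (j + i) + 1) (j + i + 1 + j) = G at *
    rw [sg']
    push_cast
    linear_combination G * ((-1) ^ (j + i) * (-1) ^ j) * i * e1 +
      G * ((-1) ^ (j + i + 1 + j)) * (j + i + 1 + j) * e2
  rw [sum_congr rfl t, ← mul_sum] at h
  have hne : ((-1) ^ (n + 1) * q ^ (n.choose 2 + n * n + n)) ≠ 0 :=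
    mul_ne_zero (pow_ne_zero _ (by simp)) (pow_ne_zero _ hq)
  apply mul_left_cancel₀ hne
  rw [← h]
  ring

end general

open PowerSeries

instance : Fact (Nat.Prime 7) := ⟨by norm_num⟩

/-- Base ring. -/
abbrev A := PowerSeries (ZMod 7)

/-- Euler function mod 7. -/
noncomputable def phi : A := pentagonalSeries (ZMod 7)

/-- Partition series mod 7. -/
noncomputable def PS : A := PowerSeries.mk fun n => (P n : ZMod 7)

open scoped PowerSeries.WithPiTopology in
lemma phi_mul_PS : phi * PS = 1 := by
  let _i : TopologicalSpace (ZMod 7) := ⊥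
  have : DiscreteTopology (ZMod 7) := ⟨rfl⟩
  have h1 := WithPiTopology.hasProd_one_sub_X_pow (ZMod 7)
  have h2 := Nat.Partition.hasProd_powerSeriesMk_card_restricted (ZMod 7) (fun _ => True)
  have h3 := h1.mul h2
  have h4 : ∀ i : ℕ, (1 - X ^ (i + 1) : A) *
      (if True then ∑' j : ℕ, (X : A) ^ ((i + 1) * j) else 1) = 1 := by
    intro i
    simp_rw [if_true, pow_mul]
    rw [mul_comm]
    exact WithPiTopology.tsum_pow_mul_one_sub_of_constantCoeff_eq_zero (by simp)
  simp only [h4] at h3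
  have h5 := h3.unique hasProd_one
  have h6 : PS = PowerSeries.mk fun n =>
      ((Nat.Partition.restricted n (fun _ => True)).card : ZMod 7) := by
    ext n
    simp [PS, P, Nat.Partition.restricted]
  rw [h6, phi]
  exact h5

lemma E_trunc (n m : ℕ) (h : n ≤ m) : (X : A) ^ (n + 1) ∣ E X m - E X n := by
  induction m, h using Nat.le_induction with
  | base => simp
  | succ m hm ih =>
    rw [E_succ]
    have : (X : A) ^ (n + 1) ∣ X ^ (m + 1) := pow_dvd_pow _ (by omega)
    have := ih.sub (this.mul_left (E X m))
    convert this using 1; ring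

lemma phi_trunc (n m : ℕ) (h : n ≤ m) : (X : A) ^ (n + 1) ∣ phi - E X m := by
  rw [X_pow_dvd_iff]
  intro k hk
  have h1 := coeff_prod_one_sub_X_pow_eventually_eq (ZMod 7) k
  rw [Filter.eventually_atTop] at h1
  obtain ⟨s, hs⟩ := h1
  obtain ⟨N, hN⟩ := s.exists_nat_subset_range
  have h2 := hs (range (max N m)) (hN.trans (range_subset_range.2 (le_max_left _ _)))
  have h3 := X_pow_dvd_iff.1 (E_trunc m (max N m) (le_max_right _ _)) k (by omega)
  rw [map_sub] at h3 ⊢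
  rw [phi, ← h2]
  exact h3

lemma E_ne (n : ℕ) : E (X : A) n ≠ 0 := by
  intro h
  have := congrArg constantCoeff h
  simp [E, map_prod] at this

lemma gb_phi (s a b : ℕ) (h : a + b = s) (hab : b ≤ a) :
    (X : A) ^ (b + 1) ∣ gb X s a * phi - 1 := by
  have h1 := phi_trunc b a hab
  have h2 := phi_trunc b b le_rfl
  have h3 := phi_trunc b s (by omega)
  have e := gb_E (X : A) s a b h
  have key : gb X s a * phi - 1 = PS * (gb X s a * phi) * (phi - E X a) +
      PS * (gb X s a * E X a) * (phi - E X b) - PS * (phi - E X s) := by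
    linear_combination (1 - gb X s a * phi) * phi_mul_PS + PS * e
  rw [key]
  exact ((h1.mul_left _).add (h2.mul_left _)).sub (h3.mul_left _)

lemma jacobi (n : ℕ) : (X : A) ^ (n + 1) ∣ phi ^ 3 -
    ∑ j ∈ range (n + 1), (-1) ^ j * (2 * (j : A) + 1) * X ^ ((j + 1).choose 2) := by
  have h1 := phi_trunc n n le_rfl
  have hj := jacobi_fin (X_ne_zero : (X : A) ≠ 0) E_ne n
  have key : phi ^ 3 -
    ∑ j ∈ range (n + 1), (-1) ^ j * (2 * (j : A) + 1) * X ^ ((j + 1).choose 2) =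
    phi * (phi + E X n) * (phi - E X n) +
    ∑ j ∈ range (n + 1), (-1) ^ j * (2 * (j : A) + 1) * (X ^ ((j + 1).choose 2) *
      (gb X (2 * n + 1) (n + 1 + j) * phi - 1)) := by
    have : ∑ j ∈ range (n + 1), (-1) ^ j * (2 * (j : A) + 1) * (X ^ ((j + 1).choose 2) *
      (gb X (2 * n + 1) (n + 1 + j) * phi - 1)) = E X n ^ 2 * phi -
      ∑ j ∈ range (n + 1), (-1) ^ j * (2 * (j : A) + 1) * X ^ ((j + 1).choose 2) := by
      rw [hj, sum_mul, ← sum_sub_distrib]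
      exact sum_congr rfl fun j _ => by ring
    rw [this]; ring
  rw [key]
  refine (h1.mul_left _).add (dvd_sum fun j hj => Dvd.dvd.mul_left ?_ _)
  rw [mem_range] at hj
  have := gb_phi (2 * n + 1) (n + 1 + j) (n - j) (by omega) (by omega)
  refine dvd_trans (pow_dvd_pow _ ?_) (by rw [pow_add]; exact mul_dvd_mul_left _ this)
  rw [Nat.choose_succ_succ' j 1, Nat.choose_one_right]
  omega

lemma coeff_phi3 (a : ℕ) (h : coeff a (phi ^ 3) ≠ 0) :
    ∃ j : ℕ, ((2 * j + 1 : ℕ) : ZMod 7) ≠ 0 ∧ a = (j + 1).choose 2 := by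
  have hd := X_pow_dvd_iff.1 (jacobi a) a (by omega)
  rw [map_sub, sub_eq_zero] at hd
  rw [hd, map_sum] at h
  obtain ⟨j, _, hj⟩ := exists_ne_zero_of_sum_ne_zero h
  have e : (-1) ^ j * (2 * (j : A) + 1) * X ^ ((j + 1).choose 2) =
      C ((-1) ^ j * (2 * (j : ZMod 7) + 1)) * X ^ ((j + 1).choose 2) := by
    simp only [map_mul, map_pow, map_neg, map_one, map_add, map_natCast, map_ofNat]
  rw [e, coeff_C_mul, coeff_X_pow] at hj
  refine ⟨j, ?_, ?_⟩
  · intro h0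
    push_cast at h0
    simp [h0] at hj
  · by_contra hne
    simp [hne] at hj

lemma coeff_phi6 (n : ℕ) : coeff (7 * n + 5) (phi ^ 6) = 0 := by
  rw [show 6 = 3 + 3 by rfl, pow_add, coeff_mul]
  refine sum_eq_zero fun p hp => ?_
  rw [HasAntidiagonal.mem_antidiagonal] at hp
  by_contra hne
  obtain ⟨j, hj, ha⟩ := coeff_phi3 p.1 (left_ne_zero_of_mul hne)
  obtain ⟨k, hk, hb⟩ := coeff_phi3 p.2 (right_ne_zero_of_mul hne)
  have h1 := choose_two' (j + 1)
  have h2 := choose_two' (k + 1)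
  have h3 : (2 * j + 1) * (2 * j + 1) + (2 * k + 1) * (2 * k + 1) = 7 * (8 * n + 6) := by
    rw [← ha] at h1
    rw [← hb] at h2
    nlinarith
  have h4 := congrArg (Nat.cast : ℕ → ZMod 7) h3
  rw [Nat.cast_add, Nat.cast_mul, Nat.cast_mul (2 * k + 1), Nat.cast_mul 7,
    show ((7 : ℕ) : ZMod 7) = 0 by rfl, zero_mul] at h4
  revert hj hk h4
  generalize ((2 * j + 1 : ℕ) : ZMod 7) = u
  generalize ((2 * k + 1 : ℕ) : ZMod 7) = v
  revert u v
  decide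

lemma coeff_phi7 (m : ℕ) (hm : ¬ 7 ∣ m) : coeff m (phi ^ 7) = 0 := by
  have h1 : (X : A) ^ (m + 1) ∣ phi ^ 7 - E X m ^ 7 :=
    (phi_trunc m m le_rfl).trans (sub_dvd_pow_sub_pow _ _ _)
  have h2 := X_pow_dvd_iff.1 h1 m (by omega)
  rw [map_sub, sub_eq_zero] at h2
  rw [h2]
  clear h1 h2
  have : CharP A 7 := charP_of_injective_algebraMap (C_injective (R := ZMod 7)) 7
  suffices ∀ n m : ℕ, ¬ 7 ∣ m → coeff m (E (X : A) n ^ 7) = 0 from this m m hm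
  intro n
  induction n with
  | zero => intro m hm; simp [E, coeff_one]; rintro rfl; simp at hm
  | succ n ih =>
    intro m hm
    rw [E_succ, mul_pow, sub_pow_char, one_pow, ← pow_mul, mul_sub, mul_one, map_sub, ih m hm,
      coeff_mul_X_pow']
    split_ifs with hle
    · rw [ih _ (by omega)]; simp
    · simp

lemma PS_zero (n : ℕ) : coeff (7 * n + 5) PS = 0 := by
  have h : PS * phi ^ 7 = phi ^ 6 := by linear_combination phi ^ 6 * phi_mul_PS
  induction n using Nat.strong_induction_on with
  | _ n ih =>
    have h1 := congrArg (coeff (7 * n + 5)) h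
    rw [coeff_phi6, coeff_mul, sum_eq_single (7 * n + 5, 0)] at h1
    · have hc : coeff 0 (phi ^ 7) ≠ 0 := by
        intro h0
        have := congrArg (constantCoeff (R := ZMod 7)) phi_mul_PS
        simp at h0
        simp [h0] at this
      exact (mul_eq_zero.1 h1).resolve_right hc
    · rintro ⟨a, b⟩ hab hne
      rw [HasAntidiagonal.mem_antidiagonal] at hab
      simp only at hab ⊢
      by_cases hb : 7 ∣ b
      · obtain ⟨c, rfl⟩ := hb
        have : c ≠ 0 := by rintro rfl; apply hne; simp at hab ⊢; exact hab
        obtain rfl : a = 7 * (n - c) + 5 := by omega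
        rw [ih _ (by omega), zero_mul]
      · rw [coeff_phi7 b hb, mul_zero]
    · intro h; simp at h

end RamSeven

theorem ramanujan_seven (n : ℕ) : P (7 * n + 5) ≡ 0 [MOD 7] := by
  have h := RamSeven.PS_zero n
  rw [RamSeven.PS, PowerSeries.coeff_mk] at h
  rw [Nat.modEq_zero_iff_dvd]
  exact (ZMod.natCast_eq_zero_iff _ _).1 h
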